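/- The one-step call-by-value reduction relation →v of λF_{S,v} is deterministic on well-typed programs: if p is a well-typed program and p →v p1 and p →v p2, then p1 = p2. -/

import Mathlib

/-!
Language `λF_{S,v}`: explicitly typed System F extended with the
delimited-control operators shift (`S k.t`), reset (`⟨t⟩`) and throw
(`k ← t`, `⌈E⌉ ← t`), under call by value, in de Bruijn representation
(separate de Bruijn indices for term variables, continuation variables and
type variables).
-/

namespace LambdaFShift

/-- Term types: `S ::= α | (S/T → U/V) | ∀α.(S,T,U)`.
In `∀α.(S,T,U)` the quantifier binds `α` in all three components. -/
inductive Ty : Type where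
  | var : Nat → Ty
  | arrow : Ty → Ty → Ty → Ty → Ty
  | all : Ty → Ty → Ty → Ty

/-- Lifting of a renaming under a binder. -/
def liftRen (ρ : Nat → Nat) : Nat → Nat
  | 0 => 0
  | n+1 => ρ n + 1

/-- Renaming of type variables in a type. -/
def renTy (ρ : Nat → Nat) : Ty → Ty
  | .var n => .var (ρ n)
  | .arrow a b c d => .arrow (renTy ρ a) (renTy ρ b) (renTy ρ c) (renTy ρ d)
  | .all a b c => .all (renTy (liftRen ρ) a) (renTy (liftRen ρ) b) (renTy (liftRen ρ) c)

/-- Lifting of a type substitution under a type binder. -/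
def liftTySub (σ : Nat → Ty) : Nat → Ty
  | 0 => .var 0
  | n+1 => renTy Nat.succ (σ n)

/-- Simultaneous substitution of types for type variables in a type. -/
def subTy (σ : Nat → Ty) : Ty → Ty
  | .var n => σ n
  | .arrow a b c d => .arrow (subTy σ a) (subTy σ b) (subTy σ c) (subTy σ d)
  | .all a b c => .all (subTy (liftTySub σ) a) (subTy (liftTySub σ) b) (subTy (liftTySub σ) c)

/-- `subTy0 U S` is `S[α₀ := U]`. -/
def subTy0 (U : Ty) (S : Ty) : Ty :=
  subTy (fun n => match n with | 0 => U | n+1 => .var n) S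

/-- `subTyList Ts S` is `S[ᾱ := Ts]`. -/
def subTyList (Ts : List Ty) (S : Ty) : Ty :=
  subTy (fun n => Ts.getD n (.var n)) S

/-- `ScopedTy p S`: all free type variables of `S` are `< p`. -/
inductive ScopedTy : Nat → Ty → Prop where
  | var : ∀ {p n}, n < p → ScopedTy p (.var n)
  | arrow : ∀ {p a b c d}, ScopedTy p a → ScopedTy p b → ScopedTy p c → ScopedTy p d →
      ScopedTy p (.arrow a b c d)
  | all : ∀ {p a b c}, ScopedTy (p+1) a → ScopedTy (p+1) b → ScopedTy (p+1) c →
      ScopedTy p (.all a b c)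

/-- A closed type. -/
def ClosedTy (S : Ty) : Prop := ScopedTy 0 S

mutual
/-- Terms of `λF_{S,v}`: variables, `λx:S.t`, application, `Λα.t`, type
application, `S k.t` (shift), `⟨t⟩` (reset), `k ← t` and `⌈E⌉ ← t` (throw). -/
inductive Tm : Type where
  | var : Nat → Tm
  | lam : Ty → Tm → Tm
  | app : Tm → Tm → Tm
  | tlam : Tm → Tm
  | tapp : Tm → Ty → Tm
  | shift : Tm → Tm
  | reset : Tm → Tm
  | throwVar : Nat → Tm → Tm
  | throwCtx : Ctx → Tm → Tm

/-- Call-by-value evaluation contexts, represented inside-out: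
`[]`, `(λx:S.t)·E`, `E t`, `E S`, `⌈E₀⌉ ← E`. -/
inductive Ctx : Type where
  | hole : Ctx
  | lamApp : Ty → Tm → Ctx → Ctx
  | app : Ctx → Tm → Ctx
  | tapp : Ctx → Ty → Ctx
  | throw : Ctx → Ctx → Ctx
end

/-- Metacontexts: stacks of contexts, `F ::= • | E·F`. -/
abbrev MCtx : Type := List Ctx

/-- Plugging a term in a context. -/
def plug : Tm → Ctx → Tm
  | t, .hole => t
  | t, .lamApp S b E => plug (.app (.lam S b) t) E
  | t, .app E u => plug (.app t u) E
  | t, .tapp E S => plug (.tapp t S) E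
  | t, .throw E0 E => plug (.throwCtx E0 t) E

/-- Plugging a term in a metacontext:
`plugm t • = t` and `plugm t (E·F) = plugm ⟨E[t]⟩ F`.
In particular `plugm t (E::F)` is `F[⟨E[t]⟩]`. -/
def plugm : Tm → MCtx → Tm
  | t, [] => t
  | t, E :: F => plugm (.reset (plug t E)) F

/-- Values: λ-abstractions and Λ-abstractions. -/
inductive IsValue : Tm → Prop where
  | lam : ∀ {S t}, IsValue (.lam S t)
  | tlam : ∀ {t}, IsValue (.tlam t)

/-- Plain terms: no subterm of the form `⌈E⌉ ← t`. -/
inductive Plain : Tm → Prop where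
  | var : ∀ {n}, Plain (.var n)
  | lam : ∀ {S t}, Plain t → Plain (.lam S t)
  | app : ∀ {a b}, Plain a → Plain b → Plain (.app a b)
  | tlam : ∀ {t}, Plain t → Plain (.tlam t)
  | tapp : ∀ {t S}, Plain t → Plain (.tapp t S)
  | shift : ∀ {t}, Plain t → Plain (.shift t)
  | reset : ∀ {t}, Plain t → Plain (.reset t)
  | throwVar : ∀ {k t}, Plain t → Plain (.throwVar k t)

mutual
/-- Scoping predicate for terms: free term variables `< n`, free continuation
variables `< m`, free type variables `< p`. -/
inductive ScTm : Nat → Nat → Nat → Tm → Prop where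
  | var : ∀ {n m p x}, x < n → ScTm n m p (.var x)
  | lam : ∀ {n m p S t}, ScopedTy p S → ScTm (n+1) m p t → ScTm n m p (.lam S t)
  | app : ∀ {n m p a b}, ScTm n m p a → ScTm n m p b → ScTm n m p (.app a b)
  | tlam : ∀ {n m p t}, ScTm n m (p+1) t → ScTm n m p (.tlam t)
  | tapp : ∀ {n m p t S}, ScTm n m p t → ScopedTy p S → ScTm n m p (.tapp t S)
  | shift : ∀ {n m p t}, ScTm n (m+1) p t → ScTm n m p (.shift t)
  | reset : ∀ {n m p t}, ScTm n m p t → ScTm n m p (.reset t)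
  | throwVar : ∀ {n m p k t}, k < m → ScTm n m p t → ScTm n m p (.throwVar k t)
  | throwCtx : ∀ {n m p E t}, ScCtx n m p E → ScTm n m p t → ScTm n m p (.throwCtx E t)

/-- Scoping predicate for contexts. -/
inductive ScCtx : Nat → Nat → Nat → Ctx → Prop where
  | hole : ∀ {n m p}, ScCtx n m p .hole
  | lamApp : ∀ {n m p S t E}, ScopedTy p S → ScTm (n+1) m p t → ScCtx n m p E →
      ScCtx n m p (.lamApp S t E)
  | app : ∀ {n m p E t}, ScCtx n m p E → ScTm n m p t → ScCtx n m p (.app E t)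
  | tapp : ∀ {n m p E S}, ScCtx n m p E → ScopedTy p S → ScCtx n m p (.tapp E S)
  | throw : ∀ {n m p E0 E1}, ScCtx n m p E0 → ScCtx n m p E1 → ScCtx n m p (.throw E0 E1)
end

/-- A closed term. -/
def ClosedTm (t : Tm) : Prop := ScTm 0 0 0 t

/-- A closed context. -/
def ClosedCtx (E : Ctx) : Prop := ScCtx 0 0 0 E

/-- A closed metacontext. -/
def ClosedMCtx (F : MCtx) : Prop := ∀ E ∈ F, ClosedCtx E

mutual
/-- Renaming of the three kinds of variables in terms. -/
def renTm (ρx ρk ρa : Nat → Nat) : Tm → Tm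
  | .var n => .var (ρx n)
  | .lam S t => .lam (renTy ρa S) (renTm (liftRen ρx) ρk ρa t)
  | .app a b => .app (renTm ρx ρk ρa a) (renTm ρx ρk ρa b)
  | .tlam t => .tlam (renTm ρx ρk (liftRen ρa) t)
  | .tapp t S => .tapp (renTm ρx ρk ρa t) (renTy ρa S)
  | .shift t => .shift (renTm ρx (liftRen ρk) ρa t)
  | .reset t => .reset (renTm ρx ρk ρa t)
  | .throwVar k t => .throwVar (ρk k) (renTm ρx ρk ρa t)
  | .throwCtx E t => .throwCtx (renCtx ρx ρk ρa E) (renTm ρx ρk ρa t)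

/-- Renaming of the three kinds of variables in contexts. -/
def renCtx (ρx ρk ρa : Nat → Nat) : Ctx → Ctx
  | .hole => .hole
  | .lamApp S t E => .lamApp (renTy ρa S) (renTm (liftRen ρx) ρk ρa t) (renCtx ρx ρk ρa E)
  | .app E t => .app (renCtx ρx ρk ρa E) (renTm ρx ρk ρa t)
  | .tapp E S => .tapp (renCtx ρx ρk ρa E) (renTy ρa S)
  | .throw E0 E => .throw (renCtx ρx ρk ρa E0) (renCtx ρx ρk ρa E)
end

/-- Action of a context transformer on continuation-substitution entries. -/
def mapKEnt (f : Ctx → Ctx) : Ctx ⊕ Nat → Ctx ⊕ Nat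
  | .inl E => .inl (f E)
  | .inr n => .inr n

/-- Lifting of a term substitution under a term binder. -/
def liftSubX (σ : Nat → Tm) : Nat → Tm
  | 0 => .var 0
  | n+1 => renTm Nat.succ id id (σ n)

/-- Shifting of a term substitution under a continuation binder. -/
def shiftSubXk (σ : Nat → Tm) : Nat → Tm := fun n => renTm id Nat.succ id (σ n)

/-- Shifting of a term substitution under a type binder. -/
def shiftSubXa (σ : Nat → Tm) : Nat → Tm := fun n => renTm id id Nat.succ (σ n)

/-- Lifting of a continuation substitution under a continuation binder. -/
def liftSubK (σ : Nat → Ctx ⊕ Nat) : Nat → Ctx ⊕ Nat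
  | 0 => .inr 0
  | n+1 =>
    match σ n with
    | .inl E => .inl (renCtx id Nat.succ id E)
    | .inr m => .inr (m+1)

/-- Shifting of a continuation substitution under a term binder. -/
def shiftSubKx (σ : Nat → Ctx ⊕ Nat) : Nat → Ctx ⊕ Nat :=
  fun n => mapKEnt (renCtx Nat.succ id id) (σ n)

/-- Shifting of a continuation substitution under a type binder. -/
def shiftSubKa (σ : Nat → Ctx ⊕ Nat) : Nat → Ctx ⊕ Nat :=
  fun n => mapKEnt (renCtx id id Nat.succ) (σ n)

mutual
/-- Simultaneous capture-avoiding substitution in terms. -/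
def subTm (σx : Nat → Tm) (σk : Nat → Ctx ⊕ Nat) (σa : Nat → Ty) : Tm → Tm
  | .var n => σx n
  | .lam S t => .lam (subTy σa S) (subTm (liftSubX σx) (shiftSubKx σk) σa t)
  | .app a b => .app (subTm σx σk σa a) (subTm σx σk σa b)
  | .tlam t => .tlam (subTm (shiftSubXa σx) (shiftSubKa σk) (liftTySub σa) t)
  | .tapp t S => .tapp (subTm σx σk σa t) (subTy σa S)
  | .shift t => .shift (subTm (shiftSubXk σx) (liftSubK σk) σa t)
  | .reset t => .reset (subTm σx σk σa t)
  | .throwVar k t =>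
    match σk k with
    | .inl E => .throwCtx E (subTm σx σk σa t)
    | .inr m => .throwVar m (subTm σx σk σa t)
  | .throwCtx E t => .throwCtx (subCtx σx σk σa E) (subTm σx σk σa t)

/-- Simultaneous capture-avoiding substitution in contexts. -/
def subCtx (σx : Nat → Tm) (σk : Nat → Ctx ⊕ Nat) (σa : Nat → Ty) : Ctx → Ctx
  | .hole => .hole
  | .lamApp S t E => .lamApp (subTy σa S) (subTm (liftSubX σx) (shiftSubKx σk) σa t) (subCtx σx σk σa E)
  | .app E t => .app (subCtx σx σk σa E) (subTm σx σk σa t)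
  | .tapp E S => .tapp (subCtx σx σk σa E) (subTy σa S)
  | .throw E0 E => .throw (subCtx σx σk σa E0) (subCtx σx σk σa E)
end

/-- `sub0X v t` is `t[x₀ := v]`. -/
def sub0X (v : Tm) (t : Tm) : Tm :=
  subTm (fun n => match n with | 0 => v | n+1 => .var n) Sum.inr Ty.var t

/-- `sub0A S t` is `t[α₀ := S]`. -/
def sub0A (S : Ty) (t : Tm) : Tm :=
  subTm Tm.var Sum.inr (fun n => match n with | 0 => S | n+1 => .var n) t

/-- `sub0K E t` is `t[k₀ := ⌈E⌉]`. -/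
def sub0K (E : Ctx) (t : Tm) : Tm :=
  subTm Tm.var (fun n => match n with | 0 => .inl E | n+1 => .inr n) Ty.var t

/-- `msub Vs vs Es t` is the simultaneous substitution
`t[ᾱ := Vs][x̄ := vs][k̄ := ⌈Es⌉]`. -/
def msub (Vs : List Ty) (vs : List Tm) (Es : List Ctx) (t : Tm) : Tm :=
  subTm (fun n => vs.getD n (.var n))
        (fun n => match Es[n]? with | some E => .inl E | none => .inr n)
        (fun n => Vs.getD n (.var n)) t

mutual
/-- The type system of Figure 2: typing of terms.
`HasTy Γ Δ T t S U` encodes the judgment `Γ;Δ,T ⊢ t : S,U`, where `Γ` assigns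
term types to term variables and `Δ` assigns context types `¬(S,T)`
(represented by the pair `(S,T)`) to continuation variables. -/
inductive HasTy : List Ty → List (Ty × Ty) → Ty → Tm → Ty → Ty → Prop where
  | var : ∀ {Γ Δ x S T}, Γ[x]? = some S → HasTy Γ Δ T (.var x) S T
  | lam : ∀ {Γ Δ S T U V W t}, HasTy (S::Γ) Δ U t T V →
      HasTy Γ Δ W (.lam S t) (.arrow S T U V) W
  | app : ∀ {Γ Δ S T U V W X t0 t1},
      HasTy Γ Δ X t0 (.arrow S T U W) V → HasTy Γ Δ W t1 S X →
      HasTy Γ Δ U (.app t0 t1) T V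
  | tlam : ∀ {Γ Δ S T U V t},
      HasTy (Γ.map (renTy Nat.succ)) (Δ.map (fun C => (renTy Nat.succ C.1, renTy Nat.succ C.2))) T t S U →
      HasTy Γ Δ V (.tlam t) (.all S T U) V
  | tapp : ∀ {Γ Δ S T U V W t},
      HasTy Γ Δ (subTy0 V U) t (.all S T U) W →
      HasTy Γ Δ (subTy0 V T) (.tapp t V) (subTy0 V S) W
  | reset : ∀ {Γ Δ S T U t}, HasTy Γ Δ U t U S → HasTy Γ Δ T (.reset t) S T
  | shift : ∀ {Γ Δ S T U V t}, HasTy Γ ((S,T)::Δ) V t V U →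
      HasTy Γ Δ T (.shift t) S U
  | throwVar : ∀ {Γ Δ k S T U V t}, Δ[k]? = some (S,T) → HasTy Γ Δ U t S V →
      HasTy Γ Δ U (.throwVar k t) T V
  | throwCtx : ∀ {Γ Δ E S T U V t}, HasTyCtx Γ Δ E S T → HasTy Γ Δ U t S V →
      HasTy Γ Δ U (.throwCtx E t) T V

/-- The type system of Figure 2: typing of contexts.
`HasTyCtx Γ Δ E S T` encodes `Γ;Δ ⊢ E : ¬(S,T)`. -/
inductive HasTyCtx : List Ty → List (Ty × Ty) → Ctx → Ty → Ty → Prop where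
  | hole : ∀ {Γ Δ S}, HasTyCtx Γ Δ .hole S S
  | app : ∀ {Γ Δ S T U V W t E},
      HasTyCtx Γ Δ E T U → HasTy Γ Δ V t S W →
      HasTyCtx Γ Δ (.app E t) (.arrow S T U V) W
  | lamApp : ∀ {Γ Δ S T U V W t E},
      HasTy Γ Δ W (.lam S t) (.arrow S T U V) W → HasTyCtx Γ Δ E T U →
      HasTyCtx Γ Δ (.lamApp S t E) S V
  | tapp : ∀ {Γ Δ S T U V E},
      HasTyCtx Γ Δ E (subTy0 V S) (subTy0 V T) →
      HasTyCtx Γ Δ (.tapp E V) (.all S T U) (subTy0 V U)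
  | throw : ∀ {Γ Δ S T U E' E},
      HasTyCtx Γ Δ E' S T → HasTyCtx Γ Δ E T U →
      HasTyCtx Γ Δ (.throw E' E) S U
end

/-- The type system of Figure 2: typing of metacontexts.
`HasTyMCtx Γ Δ F S` encodes `Γ;Δ ⊢ F : ¬¬S`. -/
inductive HasTyMCtx : List Ty → List (Ty × Ty) → MCtx → Ty → Prop where
  | nil : ∀ {Γ Δ S}, HasTyMCtx Γ Δ ([] : MCtx) S
  | cons : ∀ {Γ Δ S T E F}, HasTyCtx Γ Δ E S T → HasTyMCtx Γ Δ F T →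
      HasTyMCtx Γ Δ (E :: F : MCtx) S

/-- The call-by-value one-step reduction relation `→v` of `λF_{S,v}`.
Note that `plugm r (E::F)` is the program `F[⟨E[r]⟩]`. -/
inductive Step : Tm → Tm → Prop where
  | beta : ∀ {S t v E F}, IsValue v →
      Step (plugm (.app (.lam S t) v) (E::F)) (plugm (sub0X v t) (E::F))
  | betaT : ∀ {t S E F},
      Step (plugm (.tapp (.tlam t) S) (E::F)) (plugm (sub0A S t) (E::F))
  | shift : ∀ {t E F},
      Step (plugm (.shift t) (E::F)) (plugm (.reset (sub0K E t)) F)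
  | throw : ∀ {E' E F v}, IsValue v →
      Step (plugm (.throwCtx E' v) (E::F)) (plugm v (E'::E::F))
  | reset : ∀ {v E F}, IsValue v →
      Step (plugm (.reset v) (E::F)) (plugm v (E::F))

/-- Call-by-value evaluation: the reflexive-transitive closure of `→v`. -/
def Steps : Tm → Tm → Prop := Relation.ReflTransGen Step

/-- Redexes of `λF_{S,v}` under call by value. -/
inductive IsRedex : Tm → Prop where
  | beta : ∀ {S t v}, IsValue v → IsRedex (.app (.lam S t) v)
  | betaT : ∀ {t S}, IsRedex (.tapp (.tlam t) S)
  | shift : ∀ {t}, IsRedex (.shift t)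
  | throw : ∀ {E v}, IsValue v → IsRedex (.throwCtx E v)
  | reset : ∀ {v}, IsValue v → IsRedex (.reset v)

/-- `Norm p`: the program `p` evaluates to a value delimited by a reset. -/
def Norm (p : Tm) : Prop := ∃ v, IsValue v ∧ Steps p (.reset v)

/-- A reducibility candidate of type `S` is a set of closed values of type `S`. -/
def IsCand (S : Ty) (R : Set Tm) : Prop :=
  ∀ v ∈ R, IsValue v ∧ ClosedTm v ∧ ∀ W, HasTy [] [] W v S W

/-- `MCtxOK R F` is the predicate `R ⊨⊨ F`, i.e. `∀ v ∈ R, norm (F[⟨v⟩])`. -/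
def MCtxOK (R : Set Tm) (F : MCtx) : Prop := ∀ v ∈ R, Norm (plugm (.reset v) F)

/-- `MCtxAdm U R F`: `F` is a closed metacontext of type `¬¬U` with `R ⊨⊨ F`. -/
def MCtxAdm (U : Ty) (R : Set Tm) (F : MCtx) : Prop :=
  ClosedMCtx F ∧ HasTyMCtx [] [] F U ∧ MCtxOK R F

/-- `CtxOK T R R' E` is the predicate `(R,R') ⊨ E`:
`∀ v ∈ R, ∀ F, R' ⊨⊨ F → norm (F[⟨E[v]⟩])`, where `T` is the type of the
candidate `R'` (so the metacontexts `F` range over closed metacontexts of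
type `¬¬T`). -/
def CtxOK (T : Ty) (R R' : Set Tm) (E : Ctx) : Prop :=
  ∀ v ∈ R, ∀ F, MCtxAdm T R' F → Norm (plugm v (E::F))

/-- `CtxAdm S T R R' E`: `E` is a closed context of type `¬(S,T)` with `(R,R') ⊨ E`. -/
def CtxAdm (S T : Ty) (R R' : Set Tm) (E : Ctx) : Prop :=
  ClosedCtx E ∧ HasTyCtx [] [] E S T ∧ CtxOK T R R' E

/-- The parametric reducibility candidate `RED_S(ᾱ ↦ R̄)` for `λF_{S,v}`,
defined by induction on `S`.  `Ts` are the types of the candidates `Rs`. -/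
def RED : Ty → List Ty → List (Set Tm) → Set Tm
  | .var i, _, Rs => Rs.getD i ∅
  | .arrow S T U V, Ts, Rs =>
      {v0 | IsValue v0 ∧ ClosedTm v0 ∧ (∀ W, HasTy [] [] W v0 (subTyList Ts (.arrow S T U V)) W) ∧
        ∀ v1 ∈ RED S Ts Rs,
          ∀ E, CtxAdm (subTyList Ts T) (subTyList Ts U) (RED T Ts Rs) (RED U Ts Rs) E →
          ∀ F, MCtxAdm (subTyList Ts V) (RED V Ts Rs) F →
            Norm (plugm (.app v0 v1) (E::F))}
  | .all S T U, Ts, Rs =>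
      {v | IsValue v ∧ ClosedTm v ∧ (∀ W, HasTy [] [] W v (subTyList Ts (.all S T U)) W) ∧
        ∀ (V : Ty) (Rc : Set Tm), IsCand V Rc →
          ∀ E, CtxAdm (subTyList (V::Ts) S) (subTyList (V::Ts) T)
                 (RED S (V::Ts) (Rc::Rs)) (RED T (V::Ts) (Rc::Rs)) E →
          ∀ F, MCtxAdm (subTyList (V::Ts) U) (RED U (V::Ts) (Rc::Rs)) F →
            Norm (plugm (.tapp v V) (E::F))}

end LambdaFShift

namespace LambdaFShift

/-- Boolean test for values. -/
def isValueB : Tm → Bool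
  | .lam _ _ => true
  | .tlam _ => true
  | _ => false

theorem IsValue.isValueB {v : Tm} (h : IsValue v) : isValueB v = true := by
  cases h <;> rfl

/-- Search for the redex of `t`, under the current context `E` and metacontext `F`, and
contract it. -/
def reduceAt : Tm → Ctx → MCtx → Option Tm
  | .app (.lam S t) b, E, F =>
    if isValueB b then some (plugm (sub0X b t) (E :: F)) else reduceAt b (.lamApp S t E) F
  | .app a b, E, F => reduceAt a (.app E b) F
  | .tapp (.tlam t) S, E, F => some (plugm (sub0A S t) (E :: F))
  | .tapp t S, E, F => reduceAt t (.tapp E S) F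
  | .shift t, E, F => some (plugm (.reset (sub0K E t)) F)
  | .reset t, E, F =>
    if isValueB t then some (plugm t (E :: F)) else reduceAt t .hole (E :: F)
  | .throwCtx E' t, E, F =>
    if isValueB t then some (plugm t (E' :: E :: F)) else reduceAt t (.throw E' E) F
  | _, _, _ => none

/-- The call-by-value reduction of programs as a partial function. -/
def reduce : Tm → Option Tm
  | .reset t => reduceAt t .hole []
  | _ => none

theorem isValueB_plug : ∀ (E : Ctx) {t : Tm}, isValueB t = false → isValueB (plug t E) = false
  | .hole, _, h => by simpa only [plug] using h
  | .lamApp _ _ E, _, _ => by simpa only [plug] using isValueB_plug E rfl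
  | .app E _, _, _ => by simpa only [plug] using isValueB_plug E rfl
  | .tapp E _, _, _ => by simpa only [plug] using isValueB_plug E rfl
  | .throw _ E, _, _ => by simpa only [plug] using isValueB_plug E rfl

theorem reduceAt_plug (F : MCtx) :
    ∀ (E : Ctx) {t : Tm}, isValueB t = false → reduceAt (plug t E) .hole F = reduceAt t E F
  | .hole, _, _ => by simp only [plug]
  | .lamApp S b E, t, h => by
    rw [plug, reduceAt_plug F E rfl]
    simp [reduceAt, h]
  | .app E u, t, h => by
    rw [plug, reduceAt_plug F E rfl]
    cases t <;> first | rfl | cases h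
  | .tapp E S, t, h => by
    rw [plug, reduceAt_plug F E rfl]
    cases t <;> first | rfl | cases h
  | .throw E' E, t, h => by
    rw [plug, reduceAt_plug F E rfl]
    simp [reduceAt, h]

theorem reduce_plugm :
    ∀ (F : MCtx) (E : Ctx) {t : Tm}, isValueB t = false →
      reduce (plugm t (E :: F)) = reduceAt t E F
  | [], E, t, h => by
    simp only [plugm, reduce]
    exact reduceAt_plug [] E h
  | E' :: F, E, t, h => by
    rw [plugm, reduce_plugm F E' rfl, ← reduceAt_plug _ E h]
    simp [reduceAt, isValueB_plug E h]

theorem Step.reduce_eq {p q : Tm} (h : Step p q) : reduce p = some q := by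
  cases h with
  | beta hv => rw [reduce_plugm _ _ rfl]; simp [reduceAt, hv.isValueB]
  | betaT => rw [reduce_plugm _ _ rfl]; simp [reduceAt]
  | shift => rw [reduce_plugm _ _ rfl]; simp [reduceAt]
  | throw hv => rw [reduce_plugm _ _ rfl]; simp [reduceAt, hv.isValueB]
  | reset hv => rw [reduce_plugm _ _ rfl]; simp [reduceAt, hv.isValueB]

/-- **Determinism of call-by-value reduction in `λF_{S,v}`.**  The one-step
reduction relation `→v` is deterministic on well-typed programs: if `p` is a
well-typed program (a closed plain term delimited by a reset, typable in the
empty environments) and `p →v p₁` and `p →v p₂`, then `p₁ = p₂`. -/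
theorem step_deterministic
    (p p₁ p₂ : Tm) (hclosed : ClosedTm p) (hplain : Plain p)
    (hreset : ∃ t, p = Tm.reset t)
    (htyped : ∃ S T U, HasTy ([] : List Ty) ([] : List (Ty × Ty)) T p S U)
    (h₁ : Step p p₁) (h₂ : Step p p₂) :
    p₁ = p₂ :=
  Option.some.inj (h₁.reduce_eq.symm.trans h₂.reduce_eq)

end LambdaFShift
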